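/- Let p ≥ 1 and q ≥ 1 be integers with p+q even. Then the alternating linear Euler T-sum T_{p,q}^{1,−1} lies in the subalgebra of ℝ generated over ℚ by the set {π, ln 2, G} ∪ {ζ(2k+1) : k ≥ 1} ∪ {β(2k) : k ≥ 2}; and if moreover q ≥ 2, the alternating linear Euler T-sum T_{p,q}^{−1,1} also lies in that subalgebra. -/

import Mathlib

open scoped BigOperators

/-- Alternating odd harmonic number `h_n^{(p)}(σ) = ∑_{k=1}^n σ^{k-1}/(k-1/2)^p`. -/
noncomputable def oddH (n p : ℕ) (σ : ℝ) : ℝ :=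
  ∑ k ∈ Finset.range n, σ ^ k / ((k : ℝ) + 1 / 2) ^ p

/-- Linear Euler T-sum `T_{p,q}^{σ1,σ2} = ∑_{n≥1} σ2^{n-1} h_{n-1}^{(p)}(σ1)/(n-1/2)^q`. -/
noncomputable def TSum (p q : ℕ) (σ1 σ2 : ℝ) : ℝ :=
  ∑' n : ℕ, σ2 ^ n * oddH n p σ1 / ((n : ℝ) + 1 / 2) ^ q

/-- The Riemann zeta value `ζ(s) = ∑_{n≥1} 1/n^s`. -/
noncomputable def zetaVal (s : ℕ) : ℝ := ∑' n : ℕ, 1 / ((n : ℝ) + 1) ^ s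

/-- The Dirichlet beta value `β(s) = ∑_{n≥1} (-1)^{n-1}/(2n-1)^s`. -/
noncomputable def betaVal (s : ℕ) : ℝ := ∑' n : ℕ, (-1 : ℝ) ^ n / (2 * (n : ℝ) + 1) ^ s

/-- finite partial sums -/
noncomputable def Zf (σ : ℝ) (p K : ℕ) (s : ℝ) : ℝ :=
  ∑ k ∈ Finset.range K, σ ^ k / ((k : ℝ) + s) ^ p

noncomputable def bv (p : ℕ) : ℝ :=
  if Odd p then 2 * (2 ^ p * (if p = 1 then Real.pi / 4 else betaVal p)) else 0

noncomputable def Av : ℕ → ℕ → ℕ → ℝ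
  | q, 0, _ => bv q
  | 0, (p + 1), k => - (-1) ^ k * bv (p + 1)
  | (q + 1), (p + 1), k => (1 / (k : ℝ)) * (Av (q + 1) p k + Av q (p + 1) k)

open Filter Topology

lemma half_pow (n p : ℕ) : (1:ℝ) / ((n : ℝ) + 1 / 2) ^ p = 2 ^ p * (1 / (2 * (n:ℝ) + 1) ^ p) := by
  have : (n:ℝ) + 1/2 = (2 * n + 1) / 2 := by ring
  rw [this, div_pow]; field_simp

lemma summable_half (p : ℕ) (hp : 2 ≤ p) : Summable (fun n : ℕ => (1:ℝ) / ((n : ℝ) + 1 / 2) ^ p) := by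
  have h := (Real.summable_one_div_nat_add_rpow (1/2) p).2 (by exact_mod_cast hp)
  refine h.congr ?_
  intro n
  rw [abs_of_pos (by positivity), Real.rpow_natCast]

lemma summable_half_sign (p : ℕ) (hp : 2 ≤ p) (σ : ℝ) (hσ : |σ| = 1) :
    Summable (fun n : ℕ => σ ^ n / ((n : ℝ) + 1 / 2) ^ p) := by
  refine Summable.of_norm_bounded (summable_half p hp) ?_
  intro n
  rw [Real.norm_eq_abs, abs_div, abs_pow, hσ, one_pow, abs_of_pos (by positivity : (0:ℝ) < ((n : ℝ) + 1 / 2) ^ p)]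

lemma tsum_beta (p : ℕ) : ∑' n : ℕ, (-1:ℝ) ^ n / ((n : ℝ) + 1 / 2) ^ p = 2 ^ p * betaVal p := by
  unfold betaVal
  rw [← tsum_mul_left]
  congr 1; ext n
  rw [← mul_one_div, half_pow]; ring

lemma tendsto_bv (p : ℕ) : Tendsto (fun N => ∑ n ∈ Finset.range N,
    (-1:ℝ) ^ n * (1 / ((n : ℝ) + 1 / 2) ^ p - 1 / (- ((n : ℝ) + 1 / 2)) ^ p)) atTop (𝓝 (bv p)) := by
  unfold bv
  split_ifs with h1 h2
  · subst h2
    have := (Real.tendsto_sum_pi_div_four).const_mul 4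
    convert this using 2
    · rw [Finset.mul_sum]
      refine Finset.sum_congr rfl fun n _ => ?_
      have h := half_pow n 1
      simp only [pow_one] at h ⊢
      rw [div_neg, h]; ring
    · ring
  · have hp : 2 ≤ p := by
      rcases h1 with ⟨k, rfl⟩; omega
    rw [← tsum_beta]
    have := ((summable_half_sign p hp (-1) (by simp)).hasSum.tendsto_sum_nat).const_mul 2
    convert this using 2
    rw [Finset.mul_sum]
    refine Finset.sum_congr rfl fun n _ => ?_
    rw [h1.neg_pow, div_neg]; ring
  · rw [Nat.not_odd_iff_even] at h1
    simp only [h1.neg_pow, sub_self, mul_zero, Finset.sum_const_zero]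
    exact tendsto_const_nhds

lemma half_ne (k n : ℕ) : (k:ℝ) - ((n:ℝ) + 1/2) ≠ 0 := by
  intro h
  have : (2 * (k:ℤ) : ℝ) = 2 * (n:ℤ) + 1 := by push_cast; linarith
  have h2 : 2 * (k:ℤ) = 2 * (n:ℤ) + 1 := by exact_mod_cast this
  omega

lemma tendsto_base (p : ℕ) (hp : 1 ≤ p) (k : ℕ) : Tendsto (fun N => ∑ n ∈ Finset.range N,
    (-1:ℝ) ^ n * (1 / ((k:ℝ) - ((n : ℝ) + 1 / 2)) ^ p - 1 / ((k:ℝ) + ((n : ℝ) + 1 / 2)) ^ p)) atTop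
      (𝓝 (- (-1) ^ k * bv p)) := by
  induction k with
  | zero =>
    convert (tendsto_bv p).neg using 2
    · rw [← Finset.sum_neg_distrib]
      refine Finset.sum_congr rfl fun n _ => ?_
      simp only [Nat.cast_zero, zero_sub, zero_add]; ring
    · simp
  | succ k ih =>
    have key : ∀ N : ℕ, ∑ n ∈ Finset.range N,
      (-1:ℝ) ^ n * (1 / (((k+1:ℕ):ℝ) - ((n : ℝ) + 1 / 2)) ^ p - 1 / (((k+1:ℕ):ℝ) + ((n : ℝ) + 1 / 2)) ^ p)
      = - ∑ n ∈ Finset.range N,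
      (-1:ℝ) ^ n * (1 / ((k:ℝ) - ((n : ℝ) + 1 / 2)) ^ p - 1 / ((k:ℝ) + ((n : ℝ) + 1 / 2)) ^ p)
       + (-1) ^ N * (1 / ((N:ℝ) + (k + 1/2)) ^ p) - (-1) ^ N * (1 / ((k:ℝ) + 1/2 - N) ^ p) := by
      intro N
      induction N with
      | zero => simp
      | succ N ihN =>
        rw [Finset.sum_range_succ, ihN, Finset.sum_range_succ]
        have e1 : ((k+1:ℕ):ℝ) - ((N : ℝ) + 1 / 2) = (k:ℝ) + 1/2 - N := by push_cast; ring
        have e2 : ((k+1:ℕ):ℝ) + ((N : ℝ) + 1 / 2) = ((N+1:ℕ):ℝ) + (k + 1/2) := by push_cast; ring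
        have e3 : (k:ℝ) - ((N : ℝ) + 1 / 2) = (k:ℝ) + 1/2 - ((N+1:ℕ):ℝ) := by push_cast; ring
        have e4 : (k:ℝ) + ((N : ℝ) + 1 / 2) = (N:ℝ) + (k + 1/2) := by ring
        rw [e1, e2, e3, e4]; ring
    simp_rw [key]
    have t1 : Tendsto (fun N : ℕ => (-1:ℝ) ^ N * (1 / ((N:ℝ) + (k + 1/2)) ^ p)) atTop (𝓝 0) := by
      rw [tendsto_zero_iff_abs_tendsto_zero]
      have : Tendsto (fun N : ℕ => 1 / ((N:ℝ) + (k + 1/2)) ^ p) atTop (𝓝 0) := by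
        apply Tendsto.div_atTop tendsto_const_nhds
        exact (tendsto_pow_atTop (by omega)).comp
          (tendsto_atTop_add_const_right _ _ tendsto_natCast_atTop_atTop)
      have := this.abs
      simpa [Function.comp_def, abs_mul] using this
    have t2 : Tendsto (fun N : ℕ => (-1:ℝ) ^ N * (1 / ((k:ℝ) + 1/2 - N) ^ p)) atTop (𝓝 0) := by
      rw [tendsto_zero_iff_abs_tendsto_zero]
      have : Tendsto (fun N : ℕ => 1 / ((N:ℝ) + (- k - 1/2)) ^ p) atTop (𝓝 0) := by
        apply Tendsto.div_atTop tendsto_const_nhds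
        exact (tendsto_pow_atTop (by omega)).comp
          (tendsto_atTop_add_const_right _ _ tendsto_natCast_atTop_atTop)
      have := this.abs
      rw [abs_zero] at this
      refine this.congr ?_
      intro N
      simp only [Function.comp_apply, abs_mul, abs_pow, abs_neg, abs_one, one_pow, one_mul, abs_div]
      congr 2
      rw [← abs_neg]; congr 1; ring
    have := (ih.neg.add t1).sub t2
    convert this using 2
    ring

lemma tendsto_Av (q p k : ℕ) (hk : 1 ≤ k) : Tendsto (fun N => ∑ n ∈ Finset.range N,
    (-1:ℝ) ^ n * (1 / (((n : ℝ) + 1 / 2) ^ q * ((k:ℝ) - ((n : ℝ) + 1 / 2)) ^ p)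
      - 1 / ((-((n : ℝ) + 1 / 2)) ^ q * ((k:ℝ) + ((n : ℝ) + 1 / 2)) ^ p))) atTop
      (𝓝 (Av q p k)) := by
  induction q, p, k using Av.induct with
  | case1 q k => simpa [Av] using tendsto_bv q
  | case2 p k => simpa [Av] using tendsto_base (p+1) (by omega) k
  | case3 q p k ih1 ih2 =>
    rw [Av]
    convert ((ih1 hk).add (ih2 hk)).const_mul (1 / (k:ℝ)) using 2
    rw [← Finset.sum_add_distrib, Finset.mul_sum]
    refine Finset.sum_congr rfl fun n _ => ?_
    rw [← mul_add, mul_left_comm]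
    congr 1
    have h1 : (n:ℝ) + 1/2 ≠ 0 := by positivity
    have h2 := half_ne k n
    have h3 : (k:ℝ) + ((n:ℝ) + 1/2) ≠ 0 := by positivity
    have h4 : (k:ℝ) ≠ 0 := by positivity
    have gen : ∀ s t : ℝ, s ≠ 0 → t ≠ 0 → s + t = k → 1 / (s ^ (q+1) * t ^ (p+1)) =
      1 / (k:ℝ) * (1 / (s ^ (q+1) * t ^ p) + 1 / (s ^ q * t ^ (p+1))) := by
      intro s t hs ht hst
      rw [← hst] at h4 ⊢
      field_simp
      ring
    rw [gen _ _ h1 h2 (by ring), gen _ _ (neg_ne_zero.2 h1) h3 (by ring)]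
    ring

lemma Zf_succ (σ : ℝ) (hσ : σ * σ = 1) (p K : ℕ) (s : ℝ) :
    Zf σ p K (s + 1) = σ * (Zf σ p K s - 1 / s ^ p + σ ^ K / (K + s) ^ p) := by
  unfold Zf
  induction K with
  | zero => simp
  | succ K ih =>
    rw [Finset.sum_range_succ, ih, Finset.sum_range_succ]
    have : (K:ℝ) + (s + 1) = ((K+1:ℕ):ℝ) + s := by push_cast; ring
    rw [this]
    have h2 : σ * (σ ^ (K+1) / (((K+1:ℕ):ℝ) + s) ^ p) = σ ^ K / (((K+1:ℕ):ℝ) + s) ^ p := by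
      rw [pow_succ, ← mul_div_assoc]; congr 1
      linear_combination σ ^ K * hσ
    linear_combination - h2
lemma Zf_pred (σ : ℝ) (hσ : σ * σ = 1) (p K : ℕ) (s : ℝ) :
    Zf σ p K s = σ * Zf σ p K (s + 1) + 1 / s ^ p - σ ^ K / (K + s) ^ p := by
  rw [Zf_succ σ hσ]
  linear_combination - (Zf σ p K s - 1 / s ^ p + σ ^ K / (K + s) ^ p) * hσ

lemma tendsto_tail (σ : ℝ) (hσ : |σ| = 1) (p : ℕ) (hp : 1 ≤ p) (s : ℝ) :
    Tendsto (fun K : ℕ => σ ^ K / ((K:ℝ) + s) ^ p) atTop (𝓝 0) := by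
  rw [tendsto_zero_iff_abs_tendsto_zero]
  have : Tendsto (fun N : ℕ => 1 / ((N:ℝ) + s) ^ p) atTop (𝓝 0) := by
    apply Tendsto.div_atTop tendsto_const_nhds
    exact (tendsto_pow_atTop (by omega)).comp
      (tendsto_atTop_add_const_right _ _ tendsto_natCast_atTop_atTop)
  have := this.abs
  rw [abs_zero] at this
  refine this.congr ?_
  intro N
  simp only [Function.comp_apply, abs_div, abs_pow, hσ, one_pow, abs_one]

lemma Zlim_pos (σ : ℝ) (hσ : σ * σ = 1) (hσ' : |σ| = 1) (p : ℕ) (hp : 1 ≤ p) (c : ℕ → ℝ)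
    (hc : ∀ K, σ * c K = c K) (L : ℝ)
    (hL : Tendsto (fun K => oddH K p σ - c K) atTop (𝓝 L)) (n : ℕ) :
    Tendsto (fun K => Zf σ p K ((n:ℝ) + 1/2) - c K) atTop (𝓝 (σ ^ n * (L - oddH n p σ))) := by
  induction n with
  | zero => simpa [Zf, oddH] using hL
  | succ n ih =>
    have h := ((ih.sub_const (1 / ((n:ℝ) + 1/2) ^ p)).add
      (tendsto_tail σ hσ' p hp ((n:ℝ) + 1/2))).const_mul σ
    have e : ((n+1:ℕ):ℝ) + 1/2 = ((n:ℝ) + 1/2) + 1 := by push_cast; ring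
    rw [e]
    refine Tendsto.congr ?_ (le_trans h (le_of_eq (congrArg 𝓝 ?_)))
    · intro K
      rw [Zf_succ σ hσ]
      linear_combination - hc K
    · have h2 : σ ^ n * σ ^ n = 1 := by rw [← mul_pow, hσ, one_pow]
      unfold oddH
      rw [Finset.sum_range_succ]
      linear_combination σ * (1 / ((n:ℝ) + 1/2) ^ p) * h2

lemma Zlim_neg (σ : ℝ) (hσ : σ * σ = 1) (hσ' : |σ| = 1) (p : ℕ) (hp : 1 ≤ p) (c : ℕ → ℝ)
    (hc : ∀ K, σ * c K = c K) (L : ℝ)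
    (hL : Tendsto (fun K => oddH K p σ - c K) atTop (𝓝 L)) (n : ℕ) :
    Tendsto (fun K => Zf σ p K (-((n:ℝ) + 1/2)) - c K) atTop
      (𝓝 (σ ^ (n + 1) * L + (-1) ^ p * σ ^ n * oddH (n + 1) p σ)) := by
  have step : ∀ (n : ℕ) (l : ℝ), 
    Tendsto (fun K => Zf σ p K (-((n:ℝ) + 1/2) + 1) - c K) atTop (𝓝 l) → 
    Tendsto (fun K => Zf σ p K (-((n:ℝ) + 1/2)) - c K) atTop 
      (𝓝 (σ * l + (-1) ^ p * (1 / ((n:ℝ) + 1/2) ^ p))) := by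
    intro n l h
    have h := ((h.const_mul σ).add_const (1 / (-((n:ℝ) + 1/2)) ^ p)).sub
      (tendsto_tail σ hσ' p hp (-((n:ℝ) + 1/2)))
    refine Tendsto.congr ?_ (le_trans h (le_of_eq (congrArg 𝓝 ?_)))
    · intro K
      rw [Zf_pred σ hσ p K (-((n:ℝ) + 1/2))]
      linear_combination - hc K
    · rw [sub_zero, neg_pow ((n:ℝ) + 1/2) p]
      congr 1
      rcases neg_one_pow_eq_or ℝ p with h | h <;> rw [h] <;> simp
  induction n with
  | zero =>
    have := step 0 L (by
      refine hL.congr ?_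
      intro K
      simp only [Zf, oddH]
      norm_num)
    convert this using 2
    simp [oddH]
  | succ n ih =>
    have h := step (n+1) _ (by
      have e : -(((n+1:ℕ):ℝ) + 1/2) + 1 = -((n:ℝ) + 1/2) := by push_cast; ring
      rw [e]; exact ih)
    convert h using 2
    have h2 : σ ^ (n+1) * σ ^ (n+1) = 1 := by rw [← mul_pow, hσ, one_pow]
    conv_lhs => unfold oddH
    rw [Finset.sum_range_succ, ← oddH]
    linear_combination (-1) ^ p * (1 / (((n+1:ℕ):ℝ) + 1/2) ^ p) * h2

lemma summable_dom (e q : ℕ) (hq : e + 2 ≤ q) (C : ℝ) :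
    Summable (fun n : ℕ => C * ((n:ℝ) + 1) ^ e * (1 / ((n:ℝ) + 1/2) ^ q)) := by
  have h := (summable_half (q - e) (by omega)).mul_left (|C| * 2 ^ e)
  refine Summable.of_norm_bounded h ?_
  intro n
  have hpos : (0:ℝ) < (n:ℝ) + 1/2 := by positivity
  rw [Real.norm_eq_abs, abs_mul, abs_mul, abs_of_nonneg (by positivity : (0:ℝ) ≤ ((n:ℝ)+1)^e),
    abs_of_nonneg (by positivity : (0:ℝ) ≤ 1 / ((n:ℝ) + 1/2) ^ q)]
  have h1 : ((n:ℝ)+1)^e ≤ 2 ^ e * ((n:ℝ) + 1/2) ^ e := by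
    rw [← mul_pow]
    apply pow_le_pow_left₀ (by positivity)
    have : (0:ℝ) ≤ n := by positivity
    linarith
  have h2 : 1 / ((n:ℝ) + 1/2) ^ (q - e) = ((n:ℝ) + 1/2) ^ e * (1 / ((n:ℝ) + 1/2) ^ q) := by
    have : q = (q - e) + e := by omega
    conv_rhs => rw [this, pow_add]
    field_simp
  rw [h2]
  calc |C| * ((n:ℝ)+1)^e * (1 / ((n:ℝ) + 1/2) ^ q)
      ≤ |C| * (2 ^ e * ((n:ℝ) + 1/2) ^ e) * (1 / ((n:ℝ) + 1/2) ^ q) := by gcongr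
    _ = _ := by ring

lemma Av_zero (q p : ℕ) (hq : 1 ≤ q) (hp : 1 ≤ p) : Av q p 0 = 0 := by
  obtain ⟨q, rfl⟩ := Nat.exists_eq_add_of_le' hq
  obtain ⟨p, rfl⟩ := Nat.exists_eq_add_of_le' hp
  simp [Av]

lemma neg_pow_inv (x : ℝ) (q : ℕ) : 1 / (-x) ^ q = (-1) ^ q * (1 / x ^ q) := by
  rw [neg_pow x q]
  rcases neg_one_pow_eq_or ℝ q with h | h <;> rw [h] <;> simp

lemma main_rel (σ : ℝ) (hσ : σ * σ = 1) (hσ' : |σ| = 1) (p q e : ℕ) (hp : 1 ≤ p)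
    (hq : e + 2 ≤ q) (hpar : (-1:ℝ) ^ p = (-1) ^ q) (c : ℕ → ℝ)
    (hc : ∀ K, σ * c K = c K) (L : ℝ)
    (hL : Tendsto (fun K => oddH K p σ - c K) atTop (𝓝 L)) (C : ℝ)
    (hb1 : ∀ K n : ℕ, |Zf σ p K ((n:ℝ) + 1/2) - c K| ≤ C * ((n:ℝ)+1) ^ e)
    (hb2 : ∀ K n : ℕ, |Zf σ p K (-((n:ℝ) + 1/2)) - c K| ≤ C * ((n:ℝ)+1) ^ e)
    (l : ℝ)
    (hl : Tendsto (fun K => ∑ k ∈ Finset.range K, σ ^ k * Av q p k - c K * bv q) atTop (𝓝 l)) :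
    2 * (-1) ^ p * TSum p q σ (-σ) + (-1) ^ p * (2 ^ (p + q) * betaVal (p + q))
      + (σ - (-1) ^ p) * L * ∑' n : ℕ, (-σ) ^ n / ((n:ℝ) + 1/2) ^ q = l := by
  set F : ℕ → ℕ → ℝ := fun K n => (-1) ^ n * (1 / ((n:ℝ) + 1/2) ^ q) *
    ((Zf σ p K (-((n:ℝ) + 1/2)) - c K) - (-1) ^ q * (Zf σ p K ((n:ℝ) + 1/2) - c K)) with hF
  set G : ℕ → ℝ := fun n => (-1) ^ n * (1 / ((n:ℝ) + 1/2) ^ q) *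
    ((σ ^ (n + 1) * L + (-1) ^ p * σ ^ n * oddH (n + 1) p σ)
      - (-1) ^ q * (σ ^ n * (L - oddH n p σ))) with hG
  have bound : ∀ K n, ‖F K n‖ ≤ (2 * C) * ((n:ℝ) + 1) ^ e * (1 / ((n:ℝ) + 1/2) ^ q) := by
    intro K n
    rw [hF, Real.norm_eq_abs, abs_mul, abs_mul, abs_pow, abs_neg, abs_one, one_pow, one_mul,
      abs_of_nonneg (by positivity : (0:ℝ) ≤ 1 / ((n:ℝ) + 1/2) ^ q), mul_comm]
    gcongr
    calc _ ≤ |Zf σ p K (-((n:ℝ) + 1/2)) - c K| + |(-1) ^ q * (Zf σ p K ((n:ℝ) + 1/2) - c K)| :=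
            abs_sub _ _
      _ ≤ C * ((n:ℝ)+1) ^ e + C * ((n:ℝ)+1) ^ e := by
            rw [abs_mul, abs_pow, abs_neg, abs_one, one_pow, one_mul]
            exact add_le_add (hb2 K n) (hb1 K n)
      _ = _ := by ring
  have hsum := summable_dom e q hq (2 * C)
  have hFs : ∀ K, Summable (F K) := fun K => Summable.of_norm_bounded hsum (bound K)
  have hlimF : Tendsto (fun K => ∑' n, F K n) atTop (𝓝 (∑' n, G n)) := by
    refine tendsto_tsum_of_dominated_convergence hsum ?_ (Eventually.of_forall bound)
    intro n
    exact ((Zlim_neg σ hσ hσ' p hp c hc L hL n).sub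
      ((Zlim_pos σ hσ hσ' p hp c hc L hL n).const_mul _)).const_mul _
  have hFv : ∀ K, ∑' n, F K n = ∑ k ∈ Finset.range K, σ ^ k * Av q p k - c K * bv q := by
    intro K
    refine tendsto_nhds_unique (hFs K).hasSum.tendsto_sum_nat ?_
    have h1 : ∀ k ∈ Finset.range K, Tendsto (fun N => σ ^ k * ∑ n ∈ Finset.range N,
      (-1:ℝ) ^ n * (1 / (((n : ℝ) + 1 / 2) ^ q * ((k:ℝ) - ((n : ℝ) + 1 / 2)) ^ p)
      - 1 / ((-((n : ℝ) + 1 / 2)) ^ q * ((k:ℝ) + ((n : ℝ) + 1 / 2)) ^ p))) atTop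
        (𝓝 (σ ^ k * Av q p k)) := by
      intro k _
      refine Tendsto.const_mul _ ?_
      rcases Nat.eq_zero_or_pos k with rfl | hk
      · rw [Av_zero q p (by omega) hp]
        refine tendsto_const_nhds.congr fun N => Eq.symm ?_
        refine Finset.sum_eq_zero fun n _ => ?_
        rw [Nat.cast_zero, zero_sub, zero_add, ← one_div_mul_one_div, neg_pow_inv, ← one_div_mul_one_div, neg_pow_inv, hpar]; ring
      · exact tendsto_Av q p k hk
    have h2 := (tendsto_finsetSum _ h1).sub ((tendsto_bv q).const_mul (c K))
    refine h2.congr ?_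
    intro N
    simp_rw [Finset.mul_sum]
    rw [Finset.sum_comm, ← Finset.sum_sub_distrib]
    refine Finset.sum_congr rfl fun n _ => ?_
    simp only [hF, Zf, neg_pow_inv, ← one_div_mul_one_div]
    have e1 : ∀ k ∈ Finset.range K, σ ^ k * ((-1) ^ n * (1 / ((n:ℝ) + 1/2) ^ q * (1 / ((k:ℝ) - ((n:ℝ) + 1/2)) ^ p) -
        (-1) ^ q * (1 / ((n:ℝ) + 1/2) ^ q) * (1 / ((k:ℝ) + ((n:ℝ) + 1/2)) ^ p)))
        = (-1) ^ n * (1 / ((n:ℝ) + 1/2) ^ q) * (σ ^ k / ((k:ℝ) + - ((n:ℝ) + 1/2)) ^ p)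
         - (-1) ^ n * (1 / ((n:ℝ) + 1/2) ^ q) * (-1) ^ q * (σ ^ k / ((k:ℝ) + ((n:ℝ) + 1/2)) ^ p) := by
      intro k _
      rw [← sub_eq_add_neg]; ring
    rw [Finset.sum_congr rfl e1, Finset.sum_sub_distrib, ← Finset.mul_sum, ← Finset.mul_sum]
    ring
  have hGl : ∑' n, G n = l := tendsto_nhds_unique hlimF (by simpa only [hFv] using hl)
  have hτ : |(-σ)| = 1 := by rwa [abs_neg]
  have s2 := (summable_half_sign (p+q) (by omega) (-1) (by simp)).mul_left ((-1:ℝ)^p)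
  have s3 := (summable_half_sign q (by omega) (-σ) hτ).mul_left ((σ - (-1) ^ p) * L)
  have hGe : ∀ n, G n = 2 * (-1) ^ p * ((-σ) ^ n * oddH n p σ / ((n:ℝ) + 1/2) ^ q)
      + (-1) ^ p * ((-1) ^ n / ((n:ℝ) + 1/2) ^ (p + q))
      + (σ - (-1) ^ p) * L * ((-σ) ^ n / ((n:ℝ) + 1/2) ^ q) := by
    intro n
    have h2 : σ ^ n * σ ^ n = 1 := by rw [← mul_pow, hσ, one_pow]
    have h3 : oddH (n+1) p σ = oddH n p σ + σ ^ n * (1 / ((n:ℝ) + 1/2) ^ p) := by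
      unfold oddH; rw [Finset.sum_range_succ]; ring
    simp only [hG, h3, ← hpar, neg_pow σ n, pow_add ((n:ℝ) + 1/2) p q]
    rw [← mul_one_div ((-1:ℝ)^n) (_ * _), ← one_div_mul_one_div]
    linear_combination (-1) ^ n * (1 / ((n:ℝ) + 1/2) ^ q) * (-1) ^ p * (1 / ((n:ℝ) + 1/2) ^ p) * h2
  have hGs : Summable G := by
    have hGb : ∀ n, ‖G n‖ ≤ (2 * C) * ((n:ℝ) + 1) ^ e * (1 / ((n:ℝ) + 1/2) ^ q) := by
      intro n
      refine le_of_tendsto (f := fun K => ‖F K n‖) (x := atTop) ?_ (Eventually.of_forall fun K => bound K n)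
      exact (((Zlim_neg σ hσ hσ' p hp c hc L hL n).sub
        ((Zlim_pos σ hσ hσ' p hp c hc L hL n).const_mul _)).const_mul _).norm
    exact Summable.of_norm_bounded hsum hGb
  have s1 : Summable (fun n : ℕ => 2 * (-1:ℝ) ^ p * ((-σ) ^ n * oddH n p σ / ((n:ℝ) + 1/2) ^ q)) := by
    refine ((hGs.sub s2).sub s3).congr ?_
    intro n
    rw [hGe]; ring
  rw [← hGl, tsum_congr hGe, (s1.add s2).tsum_add s3, s1.tsum_add s2, tsum_mul_left, tsum_mul_left, tsum_mul_left,
    tsum_beta]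
  rfl
lemma half_abs (j : ℤ) : (1:ℝ)/2 ≤ |(j:ℝ) + 1/2| := by
  rcases le_or_gt 0 j with h | h
  · have : (0:ℝ) ≤ j := by exact_mod_cast h
    rw [abs_of_nonneg (by linarith)]; linarith
  · have : (j:ℝ) ≤ -1 := by exact_mod_cast (by omega : j ≤ -1)
    rw [abs_of_nonpos (by linarith)]; linarith

lemma bound_const (σ : ℝ) (hσ' : |σ| = 1) (p : ℕ) (hp : 2 ≤ p) :
    ∃ C, ∀ (K : ℕ) (j : ℤ), |Zf σ p K ((j:ℝ) + 1/2)| ≤ C := by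
  have hs : Summable (fun j : ℤ => 1 / |(j:ℝ) + 1/2| ^ (p:ℝ)) :=
    (Real.summable_one_div_int_add_rpow (1/2) p).2 (by exact_mod_cast hp)
  refine ⟨∑' j : ℤ, 1 / |(j:ℝ) + 1/2| ^ (p:ℝ), fun K j => ?_⟩
  unfold Zf
  refine (Finset.abs_sum_le_sum_abs _ _).trans ?_
  let emb : ℕ ↪ ℤ := ⟨fun k => (k:ℤ) + j, fun a b h => by simpa using h⟩
  have := hs.sum_le_tsum ((Finset.range K).map emb) (fun _ _ => by positivity)
  rw [Finset.sum_map] at this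
  refine le_trans (le_of_eq ?_) this
  refine Finset.sum_congr rfl fun k _ => ?_
  rw [Real.rpow_natCast, abs_div, abs_pow, hσ', one_pow, abs_pow]
  have h : ((emb k : ℤ) : ℝ) = (k:ℝ) + j := by
    change (((k:ℤ) + j : ℤ) : ℝ) = _
    push_cast; ring
  rw [h, add_assoc]

lemma bound_lin (σ : ℝ) (hσ : σ * σ = 1) (hσ' : |σ| = 1) (c : ℕ → ℝ)
    (hc : ∀ K, σ * c K = c K) (L : ℝ)
    (hL : Tendsto (fun K => oddH K 1 σ - c K) atTop (𝓝 L)) :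
    ∃ C, (∀ K n : ℕ, |Zf σ 1 K ((n:ℝ) + 1/2) - c K| ≤ C * ((n:ℝ)+1) ^ 1) ∧
      (∀ K n : ℕ, |Zf σ 1 K (-((n:ℝ) + 1/2)) - c K| ≤ C * ((n:ℝ)+1) ^ 1) := by
  obtain ⟨M, hM⟩ := (Metric.isBounded_range_of_tendsto _ hL).exists_norm_le
  have hM' : ∀ K, |oddH K 1 σ - c K| ≤ M := fun K => by
    simpa using hM _ (Set.mem_range_self K)
  have hM0 : 0 ≤ M := (abs_nonneg _).trans (hM' 0)
  have inv : ∀ j : ℤ, |1 / ((j:ℝ) + 1/2)| ≤ 2 := by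
    intro j
    rw [abs_div, abs_one, div_le_iff₀ (by have := half_abs j; linarith)]
    have := half_abs j; linarith
  have inv2 : ∀ (K : ℕ) (j : ℤ), |σ ^ K / ((K:ℝ) + ((j:ℝ) + 1/2))| ≤ 2 := by
    intro K j
    have := inv ((K:ℤ) + j)
    rw [abs_div, abs_one] at this
    rw [abs_div, abs_pow, hσ', one_pow, ← add_assoc]
    push_cast at this
    exact this
  have up : ∀ (K : ℕ) (j : ℤ), |Zf σ 1 K (((j:ℝ) + 1/2) + 1) - c K| ≤
      |Zf σ 1 K ((j:ℝ) + 1/2) - c K| + 4 := by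
    intro K j
    rw [Zf_succ σ hσ, pow_one, pow_one]
    have e : σ * (Zf σ 1 K ((j:ℝ) + 1/2) - 1 / ((j:ℝ) + 1/2) + σ ^ K / ((K:ℝ) + ((j:ℝ) + 1/2))) - c K
      = σ * ((Zf σ 1 K ((j:ℝ) + 1/2) - c K) - 1 / ((j:ℝ) + 1/2) + σ ^ K / ((K:ℝ) + ((j:ℝ) + 1/2))) := by
      linear_combination hc K
    rw [e, abs_mul, hσ', one_mul]
    have h1 := inv j
    have h2 := inv2 K j
    have h3 := abs_add_le ((Zf σ 1 K ((j:ℝ) + 1/2) - c K) - 1 / ((j:ℝ) + 1/2)) (σ ^ K / ((K:ℝ) + ((j:ℝ) + 1/2)))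
    have h4 := abs_sub (Zf σ 1 K ((j:ℝ) + 1/2) - c K) (1 / ((j:ℝ) + 1/2))
    linarith
  have down : ∀ (K : ℕ) (j : ℤ), |Zf σ 1 K ((j:ℝ) + 1/2) - c K| ≤
      |Zf σ 1 K (((j:ℝ) + 1/2) + 1) - c K| + 4 := by
    intro K j
    rw [Zf_pred σ hσ 1 K ((j:ℝ) + 1/2), pow_one, pow_one]
    have e : σ * Zf σ 1 K (((j:ℝ) + 1/2) + 1) + 1 / ((j:ℝ) + 1/2) - σ ^ K / ((K:ℝ) + ((j:ℝ) + 1/2)) - c K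
      = σ * (Zf σ 1 K (((j:ℝ) + 1/2) + 1) - c K) + 1 / ((j:ℝ) + 1/2) - σ ^ K / ((K:ℝ) + ((j:ℝ) + 1/2)) := by
      linear_combination hc K
    rw [e]
    have h1 := inv j
    have h2 := inv2 K j
    have h3 := abs_sub (σ * (Zf σ 1 K (((j:ℝ) + 1/2) + 1) - c K) + 1 / ((j:ℝ) + 1/2)) (σ ^ K / ((K:ℝ) + ((j:ℝ) + 1/2)))
    have h4 := abs_add_le (σ * (Zf σ 1 K (((j:ℝ) + 1/2) + 1) - c K)) (1 / ((j:ℝ) + 1/2))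
    rw [abs_mul, hσ', one_mul] at h4
    linarith
  have base : ∀ K, Zf σ 1 K (1/2) = oddH K 1 σ := fun K => rfl
  refine ⟨M + 4, ?_, ?_⟩
  · intro K n
    have : |Zf σ 1 K ((n:ℝ) + 1/2) - c K| ≤ M + 4 * n := by
      induction n with
      | zero => simpa [← base] using hM' K
      | succ n ih =>
        have := up K n
        push_cast at this ⊢
        rw [show (n:ℝ) + 1 + 1/2 = n + 1/2 + 1 by ring]
        linarith
    have hn : (0:ℝ) ≤ n := by positivity
    nlinarith
  · intro K n
    have : |Zf σ 1 K (-((n:ℝ) + 1/2)) - c K| ≤ M + 4 * (n + 1) := by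
      induction n with
      | zero =>
        have := down K (-1)
        push_cast at this ⊢
        have h2 := hM' K
        rw [← base] at h2
        norm_num at this h2 ⊢
        linarith
      | succ n ih =>
        have := down K (-(n:ℤ) - 2)
        push_cast at this ⊢
        rw [show -(n:ℝ) - 2 + 1/2 + 1 = -((n:ℝ) + 1/2) by ring, show -(n:ℝ) - 2 + 1/2 = -((n:ℝ) + 1 + 1/2) by ring] at this
        linarith
    have hn : (0:ℝ) ≤ n := by positivity
    nlinarith
lemma harm_lim : Tendsto (fun N : ℕ => ((harmonic (2 * N) : ℚ) : ℝ) - (harmonic N : ℚ)) atTop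
    (𝓝 (Real.log 2)) := by
  have h := Real.tendsto_harmonic_sub_log
  have h2 : Tendsto (fun N : ℕ => 2 * N) atTop atTop := tendsto_id.const_mul_atTop' (by norm_num)
  have h3 := ((h.comp h2).sub h).add_const (Real.log 2)
  rw [sub_self, zero_add] at h3
  refine h3.congr' ?_
  filter_upwards [eventually_ge_atTop 1] with N hN
  simp only [Function.comp_apply]
  push_cast
  rw [Real.log_mul (by norm_num) (by positivity)]
  ring

lemma harm_sum (N : ℕ) : ∑ k ∈ Finset.range (N + 1), 1 / (k:ℝ) = (harmonic N : ℚ) := by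
  rw [Finset.sum_range_succ']
  simp [harmonic]

lemma harm_odd (N : ℕ) : oddH N 1 1 = 2 * ((harmonic (2 * N) : ℚ) : ℝ) - (harmonic N : ℚ) := by
  induction N with
  | zero => simp [oddH]
  | succ N ih =>
    have e : oddH (N+1) 1 1 = oddH N 1 1 + 1 / ((N:ℝ) + 1/2) := by
      simp [oddH, Finset.sum_range_succ]
    rw [e, ih, show 2 * (N + 1) = 2 * N + 1 + 1 by ring, harmonic_succ, harmonic_succ, harmonic_succ]
    push_cast
    field_simp
    ring

lemma lim_one : Tendsto (fun K => oddH K 1 1 - ∑ k ∈ Finset.range K, 1 / (k:ℝ)) atTop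
    (𝓝 (2 * Real.log 2)) := by
  rw [← tendsto_add_atTop_iff_nat 1]
  have h := (harm_lim.const_mul 2).add (tendsto_tail 1 (by simp) 1 le_rfl (1/2))
  rw [add_zero] at h
  refine h.congr ?_
  intro N
  have e : oddH (N+1) 1 1 = oddH N 1 1 + 1 ^ N / ((N:ℝ) + 1/2) ^ 1 := by
    simp [oddH, Finset.sum_range_succ]
  rw [harm_sum, e, harm_odd]; ring

lemma lim_alt : Tendsto (fun K => ∑ k ∈ Finset.range K, (-1:ℝ) ^ k / (k:ℝ)) atTop
    (𝓝 (- Real.log 2)) := by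
  have hodd : ∀ N, ∑ k ∈ Finset.range (2 * N + 1), (-1:ℝ) ^ k / (k:ℝ)
      = - (((harmonic (2 * N) : ℚ) : ℝ) - (harmonic N : ℚ)) := by
    intro N
    induction N with
    | zero => simp
    | succ N ih =>
      rw [show 2 * (N + 1) + 1 = 2 * N + 1 + 1 + 1 by ring, Finset.sum_range_succ,
        Finset.sum_range_succ, ih,
        show 2 * (N + 1) = 2 * N + 1 + 1 by ring, harmonic_succ, harmonic_succ, harmonic_succ]
      have h1 : (-1:ℝ) ^ (2 * N + 1) = -1 := by rw [pow_succ, pow_mul]; simp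
      have h2 : (-1:ℝ) ^ (2 * N + 1 + 1) = 1 := by rw [pow_succ, h1]; simp
      rw [h1, h2]
      push_cast
      field_simp
      ring
  have t1 : Tendsto (fun N : ℕ => ∑ k ∈ Finset.range (2 * N + 1), (-1:ℝ) ^ k / (k:ℝ)) atTop
    (𝓝 (- Real.log 2)) := by
    simp_rw [hodd]; exact harm_lim.neg
  obtain ⟨l, hl⟩ : ∃ l, Tendsto (fun K => ∑ k ∈ Finset.range K, (-1:ℝ) ^ k / (k:ℝ)) atTop (𝓝 l) := by
    have ha : Antitone (fun n : ℕ => 1 / ((n:ℝ) + 1)) := by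
      intro a b hab
      have : (a:ℝ) ≤ b := by exact_mod_cast hab
      simp only
      gcongr
    obtain ⟨l, hl⟩ := ha.tendsto_alternating_series_of_tendsto_zero tendsto_one_div_add_atTop_nhds_zero_nat
    refine ⟨-l, ?_⟩
    rw [← tendsto_add_atTop_iff_nat 1]
    refine hl.neg.congr ?_
    intro N
    rw [Finset.sum_range_succ', ← Finset.sum_neg_distrib]
    simp only [Nat.cast_zero, div_zero, add_zero]
    refine Finset.sum_congr rfl fun n _ => ?_
    push_cast; ring
  have h2 : Tendsto (fun N : ℕ => 2 * N + 1) atTop atTop :=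
    tendsto_atTop_mono (fun N => by simp only [id]; omega) tendsto_id
  have h3 : Tendsto (fun N : ℕ => ∑ k ∈ Finset.range (2 * N + 1), (-1:ℝ) ^ k / (k:ℝ)) atTop
    (𝓝 l) := hl.comp h2
  have h4 := tendsto_nhds_unique t1 h3
  rw [h4]; exact hl

lemma summable_zeta (m : ℕ) (hm : 2 ≤ m) : Summable (fun k : ℕ => 1 / (k:ℝ) ^ m) :=
  Real.summable_one_div_nat_pow.2 (by omega)

lemma zeta_eq (m : ℕ) (hm : 2 ≤ m) : ∑' k : ℕ, 1 / (k:ℝ) ^ m = zetaVal m := by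
  rw [(summable_zeta m hm).tsum_eq_zero_add]
  simp [zetaVal, show m ≠ 0 by omega]

lemma odd_zeta (m : ℕ) (hm : 2 ≤ m) :
    ∑' k : ℕ, 1 / (((2 * k + 1 : ℕ):ℝ)) ^ m = (1 - 1 / 2 ^ m) * zetaVal m := by
  have hs := summable_zeta m hm
  have he : Summable (fun k : ℕ => 1 / (((2 * k : ℕ):ℝ)) ^ m) :=
    hs.comp_injective (i := fun k => 2 * k) (fun a b h => by simpa using h)
  have ho : Summable (fun k : ℕ => 1 / (((2 * k + 1 : ℕ):ℝ)) ^ m) :=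
    hs.comp_injective (i := fun k => 2 * k + 1) (fun a b h => by simpa using h)
  have h := tsum_even_add_odd (f := fun k : ℕ => 1 / (k:ℝ) ^ m) he ho
  rw [zeta_eq m hm] at h
  have e : ∑' k : ℕ, 1 / (((2 * k : ℕ):ℝ)) ^ m = 1 / 2 ^ m * zetaVal m := by
    rw [← zeta_eq m hm, ← tsum_mul_left]
    congr 1; ext k
    push_cast; rw [mul_pow, one_div_mul_one_div]
  rw [e] at h
  linarith

lemma half_zeta (m : ℕ) (hm : 2 ≤ m) :
    ∑' n : ℕ, (1:ℝ) ^ n / ((n : ℝ) + 1 / 2) ^ m = (2 ^ m - 1) * zetaVal m := by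
  have : ∀ n : ℕ, (1:ℝ) ^ n / ((n : ℝ) + 1 / 2) ^ m = 2 ^ m * (1 / (((2 * n + 1 : ℕ):ℝ)) ^ m) := by
    intro n
    rw [one_pow, half_pow]; push_cast; rfl
  rw [tsum_congr this, tsum_mul_left, odd_zeta m hm]
  field_simp

lemma alt_zeta (m : ℕ) (hm : 2 ≤ m) :
    ∑' k : ℕ, (-1:ℝ) ^ k / (k:ℝ) ^ m = (2 / 2 ^ m - 1) * zetaVal m := by
  have hs := summable_zeta m hm
  have hs2 : Summable (fun k : ℕ => (-1:ℝ) ^ k / (k:ℝ) ^ m) := by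
    refine Summable.of_norm_bounded hs ?_
    intro n
    simp
  have he : Summable (fun k : ℕ => (-1:ℝ) ^ (2 * k) / (((2 * k : ℕ):ℝ)) ^ m) :=
    hs2.comp_injective (i := fun k => 2 * k) (fun a b h => by simpa using h)
  have ho : Summable (fun k : ℕ => (-1:ℝ) ^ (2 * k + 1) / (((2 * k + 1 : ℕ):ℝ)) ^ m) :=
    hs2.comp_injective (i := fun k => 2 * k + 1) (fun a b h => by simpa using h)
  rw [← tsum_even_add_odd (f := fun k : ℕ => (-1:ℝ) ^ k / (k:ℝ) ^ m) he ho]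
  have e : ∑' k : ℕ, (-1:ℝ) ^ (2 * k) / (((2 * k : ℕ):ℝ)) ^ m = 1 / 2 ^ m * zetaVal m := by
    rw [← zeta_eq m hm, ← tsum_mul_left]
    congr 1; ext k
    push_cast; rw [mul_pow, one_div_mul_one_div, pow_mul]; simp
  have o : ∑' k : ℕ, (-1:ℝ) ^ (2 * k + 1) / (((2 * k + 1 : ℕ):ℝ)) ^ m = - ((1 - 1 / 2 ^ m) * zetaVal m) := by
    rw [← odd_zeta m hm, ← tsum_neg]
    congr 1; ext k
    rw [pow_succ, pow_mul]; simp [neg_div]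
  rw [e, o]; ring

lemma beta_odd (k : ℕ) (hk : k ≠ 0) : ∃ r : ℚ, betaVal (2 * k + 1) = r * Real.pi ^ (2 * k + 1) := by
  have h := hasSum_one_div_nat_pow_mul_sin hk (x := 1/4) (by constructor <;> norm_num)
  have hinj : Function.Injective (fun m : ℕ => 2 * m + 1) := fun a b h => by simpa using h
  rw [← hinj.hasSum_iff] at h
  · refine ⟨(-1) ^ (k + 1) * 2 ^ (2 * k + 1) / 2 / (2 * k + 1).factorial *
      (Polynomial.bernoulli (2 * k + 1)).eval (1/4), ?_⟩
    have e : betaVal (2 * k + 1) = _ := (tsum_congr ?_).trans h.tsum_eq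
    · rw [e]
      rw [show (1/4 : ℝ) = algebraMap ℚ ℝ (1/4) by simp, Polynomial.eval_map_algebraMap,
        Polynomial.aeval_algebraMap_apply]
      simp only [Polynomial.coe_aeval_eq_eval, eq_ratCast]
      push_cast
      ring
    · intro m
      simp only [Function.comp_apply]
      have : Real.sin (2 * Real.pi * ((2 * m + 1 : ℕ):ℝ) * (1/4)) = (-1) ^ m := by
        rw [show 2 * Real.pi * ((2 * m + 1 : ℕ):ℝ) * (1/4) = Real.pi / 2 + m * Real.pi by push_cast; ring,
          Real.sin_add_nat_mul_pi]
        simp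
      rw [this]; push_cast; ring
  · intro n hn
    have hev : Even n := by
      by_contra ho
      rw [Nat.not_even_iff_odd] at ho
      obtain ⟨m, rfl⟩ := ho
      exact hn ⟨m, rfl⟩
    obtain ⟨m, rfl⟩ := hev
    rw [show 2 * Real.pi * ((m + m : ℕ):ℝ) * (1/4) = m * Real.pi by push_cast; ring, Real.sin_nat_mul_pi,
      mul_zero]

lemma bv_rat (p : ℕ) : ∃ r : ℚ, bv p = r * Real.pi ^ p := by
  unfold bv
  split_ifs with h1 h2
  · subst h2; exact ⟨1, by push_cast; ring⟩
  · obtain ⟨k, rfl⟩ := h1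
    obtain ⟨r, hr⟩ := beta_odd k (by omega)
    exact ⟨2 * 2 ^ (2 * k + 1) * r, by rw [hr]; push_cast; ring⟩
  · exact ⟨0, by simp⟩

lemma bv_even (p : ℕ) (h : ¬ Odd p) : bv p = 0 := by simp [bv, h]

/-- the algebra -/
noncomputable def Salg : Subalgebra ℚ ℝ := Algebra.adjoin ℚ
      ({Real.pi, Real.log 2, betaVal 2}
        ∪ {x : ℝ | ∃ k : ℕ, 1 ≤ k ∧ x = zetaVal (2 * k + 1)}
        ∪ {x : ℝ | ∃ k : ℕ, 2 ≤ k ∧ x = betaVal (2 * k)})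

lemma S_pi : Real.pi ∈ Salg := Algebra.subset_adjoin (by simp)
lemma S_log : Real.log 2 ∈ Salg := Algebra.subset_adjoin (by simp)
lemma S_zeta (k : ℕ) (hk : 1 ≤ k) : zetaVal (2 * k + 1) ∈ Salg :=
  Algebra.subset_adjoin (Or.inl (Or.inr ⟨k, hk, rfl⟩))
lemma S_beta (k : ℕ) (hk : 1 ≤ k) : betaVal (2 * k) ∈ Salg := by
  rcases eq_or_lt_of_le hk with h | h
  · subst h; exact Algebra.subset_adjoin (by simp)
  · exact Algebra.subset_adjoin (Or.inr ⟨k, h, rfl⟩)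
lemma S_rat (r : ℚ) : (r:ℝ) ∈ Salg := by
  have := Salg.algebraMap_mem r
  simpa using this
lemma S_two_pow (m : ℕ) : (2:ℝ) ^ m ∈ Salg := by
  have := S_rat (2 ^ m); push_cast at this; exact this
lemma S_sign (m : ℕ) : (-1:ℝ) ^ m ∈ Salg := by
  have := S_rat ((-1) ^ m); push_cast at this; exact this
lemma S_bv (p : ℕ) : bv p ∈ Salg := by
  obtain ⟨r, hr⟩ := bv_rat p
  rw [hr]; exact mul_mem (S_rat r) (pow_mem S_pi p)
lemma S_zeta_even (k : ℕ) (hk : 1 ≤ k) : zetaVal (2 * k) ∈ Salg := by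
  rw [← zeta_eq _ (by omega), (hasSum_zeta_nat (by omega : k ≠ 0)).tsum_eq]
  have := mul_mem (S_rat ((-1) ^ (k + 1) * 2 ^ (2 * k - 1) * bernoulli (2 * k) / (2 * k).factorial))
    (pow_mem S_pi (2 * k))
  convert this using 1
  push_cast; ring

/-- span of basic functions -/
noncomputable def Vs (w r : ℕ) : Submodule ℚ (ℕ → ℝ) := Submodule.span ℚ
  {f | ∃ (i m : ℕ) (ε : ℝ), (ε = 1 ∨ ε = -1) ∧ Odd i ∧ i + m = w ∧ r ≤ m ∧
    f = fun k : ℕ => Real.pi ^ i * (ε ^ k / (k:ℝ) ^ m)}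

lemma Vs_mono (w r r' : ℕ) (h : r ≤ r') : Vs w r' ≤ Vs w r := by
  refine Submodule.span_mono ?_
  rintro f ⟨i, m, ε, h1, h2, h3, h4, h5⟩
  exact ⟨i, m, ε, h1, h2, h3, h.trans h4, h5⟩

lemma Vs_sign (w r : ℕ) (σ : ℝ) (hσ : σ = 1 ∨ σ = -1) (f : ℕ → ℝ) (hf : f ∈ Vs w r) :
    (fun k => σ ^ k * f k) ∈ Vs w r := by
  induction hf using Submodule.span_induction with
  | mem f hf =>
    obtain ⟨i, m, ε, h1, h2, h3, h4, rfl⟩ := hf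
    refine Submodule.subset_span ⟨i, m, σ * ε, ?_, h2, h3, h4, ?_⟩
    · rcases hσ with rfl | rfl <;> rcases h1 with rfl | rfl <;> simp
    · ext k; rw [mul_pow]; ring
  | zero =>
    convert (Vs w r).zero_mem using 1
    ext k; simp
  | add f g _ _ hf hg =>
    convert add_mem hf hg using 1
    ext k; simp [mul_add]
  | smul a f _ hf =>
    convert (Vs w r).smul_mem a hf using 1
    ext k; simp [Rat.smul_def]; ring

lemma Vs_div (w r : ℕ) (f : ℕ → ℝ) (hf : f ∈ Vs w r) :
    (fun k : ℕ => 1 / (k:ℝ) * f k) ∈ Vs (w+1) (r+1) := by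
  induction hf using Submodule.span_induction with
  | mem f hf =>
    obtain ⟨i, m, ε, h1, h2, h3, h4, rfl⟩ := hf
    refine Submodule.subset_span ⟨i, m + 1, ε, h1, h2, by omega, by omega, ?_⟩
    ext k; rw [pow_succ, ← mul_one_div (ε ^ k) (_ * _), ← one_div_mul_one_div]; ring
  | zero =>
    convert (Vs (w+1) (r+1)).zero_mem using 1
    ext k; simp
  | add f g _ _ hf hg =>
    convert add_mem hf hg using 1
    ext k; simp [mul_add]
  | smul a f _ hf =>
    convert (Vs (w+1) (r+1)).smul_mem a hf using 1
    ext k; simp [Rat.smul_def]; ring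

lemma bv_mem (p : ℕ) (σ : ℝ) (hσ : σ = 1 ∨ σ = -1) : (fun k : ℕ => σ ^ k * bv p) ∈ Vs p 0 := by
  by_cases h : Odd p
  · obtain ⟨r, hr⟩ := bv_rat p
    have : (fun k : ℕ => Real.pi ^ p * (σ ^ k / (k:ℝ) ^ 0)) ∈ Vs p 0 :=
      Submodule.subset_span ⟨p, 0, σ, hσ, h, rfl, le_rfl, rfl⟩
    convert (Vs p 0).smul_mem r this using 1
    ext k; simp [Rat.smul_def, hr]; ring
  · convert (Vs p 0).zero_mem using 1
    ext k; simp [bv_even p h]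

lemma Av_mem (q p : ℕ) : (fun k => Av q p k) ∈ Vs (q + p) (min q p) := by
  induction p generalizing q with
  | zero => simpa [Av] using bv_mem q 1 (Or.inl rfl)
  | succ p ihp =>
    induction q with
    | zero =>
      have := (Vs (p+1) 0).neg_mem (bv_mem (p+1) (-1) (Or.inr rfl))
      rw [zero_add, Nat.zero_min]
      convert this using 1
      ext k
      change Av 0 (p+1) k = -((-1) ^ k * bv (p+1))
      rw [Av]; ring
    | succ q ihq =>
      have h1 : (fun k => Av (q+1) p k) ∈ Vs (q + 1 + p) (min q p) :=
        Vs_mono _ _ (min (q+1) p) (by omega) (ihp (q+1))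
      have h2 : (fun k => Av q (p+1) k) ∈ Vs (q + 1 + p) (min q p) := by
        rw [show q + 1 + p = q + (p + 1) by ring]
        exact Vs_mono _ _ (min q (p+1)) (by omega) ihq
      have h := Vs_div _ _ _ (add_mem h1 h2)
      rw [show min (q+1) (p+1) = min q p + 1 by omega]
      convert h using 1
      · rfl
      · exact funext fun k => Av.eq_3 k q p

lemma Vs_lim (w : ℕ) (hw : Even w) (f : ℕ → ℝ) (hf : f ∈ Vs w 2) :
    ∃ l ∈ Salg, Tendsto (fun K => ∑ k ∈ Finset.range K, f k) atTop (𝓝 l) := by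
  induction hf using Submodule.span_induction with
  | mem f hf =>
    obtain ⟨i, m, ε, h1, h2, h3, h4, rfl⟩ := hf
    have hm : Odd m := by
      subst h3
      exact (Nat.even_add'.1 hw).1 h2
    obtain ⟨j, rfl⟩ := hm
    have hz := S_zeta j (by omega)
    have hs := summable_zeta (2 * j + 1) h4
    refine ⟨Real.pi ^ i * ∑' k : ℕ, ε ^ k / (k:ℝ) ^ (2 * j + 1), mul_mem (pow_mem S_pi i) ?_, ?_⟩
    · rcases h1 with rfl | rfl
      · simp only [one_pow]
        rw [zeta_eq _ h4]; exact hz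
      · rw [alt_zeta _ h4]
        refine mul_mem ?_ hz
        have := S_rat (2 / 2 ^ (2 * j + 1) - 1)
        push_cast at this; exact this
    · have hs2 : Summable (fun k : ℕ => ε ^ k / (k:ℝ) ^ (2 * j + 1)) := by
        refine Summable.of_norm_bounded hs ?_
        intro n
        rcases h1 with rfl | rfl <;> simp
      have := hs2.hasSum.tendsto_sum_nat.const_mul (Real.pi ^ i)
      simpa only [Finset.mul_sum] using this
  | zero => exact ⟨0, zero_mem _, by simp⟩
  | add f g _ _ hf hg =>
    obtain ⟨l, hl, h⟩ := hf
    obtain ⟨l', hl', h'⟩ := hg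
    refine ⟨l + l', add_mem hl hl', ?_⟩
    simpa [Finset.sum_add_distrib] using h.add h'
  | smul a f _ hf =>
    obtain ⟨l, hl, h⟩ := hf
    refine ⟨a * l, mul_mem (S_rat a) hl, ?_⟩
    have := h.const_mul (a:ℝ)
    simpa [Rat.smul_def, Finset.mul_sum] using this
lemma finish (σ : ℝ) (p q : ℕ) (hp : 1 ≤ p) (hpar : Even (p + q)) (l X : ℝ) (hl : l ∈ Salg) (hX : X ∈ Salg)
    (h : 2 * (-1) ^ p * TSum p q σ (-σ) + (-1) ^ p * (2 ^ (p + q) * betaVal (p + q)) + X = l) :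
    TSum p q σ (-σ) ∈ Salg := by
  have hb : betaVal (p + q) ∈ Salg := by
    obtain ⟨k, hk⟩ := hpar
    rw [hk, ← two_mul]; exact S_beta k (by omega)
  have e : TSum p q σ (-σ) = ((1/2 : ℚ) : ℝ) * ((-1) ^ p * (l - (-1) ^ p * (2 ^ (p + q) * betaVal (p + q)) - X)) := by
    rw [← h]
    have h2 : ((-1:ℝ) ^ p) * (-1) ^ p = 1 := by rw [← mul_pow]; simp
    push_cast
    linear_combination - TSum p q σ (-σ) * h2
  rw [e]
  exact mul_mem (S_rat _) (mul_mem (S_sign p) (sub_mem (sub_mem hl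
    (mul_mem (S_sign p) (mul_mem (S_two_pow _) hb))) hX))

lemma S_Bneg (q : ℕ) (hq : 2 ≤ q) : ∑' n : ℕ, (-1:ℝ) ^ n / ((n:ℝ) + 1/2) ^ q ∈ Salg := by
  rw [tsum_beta]
  refine mul_mem (S_two_pow _) ?_
  rcases Nat.even_or_odd' q with ⟨k, rfl | rfl⟩
  · exact S_beta k (by omega)
  · obtain ⟨r, hr⟩ := beta_odd k (by omega)
    rw [hr]; exact mul_mem (S_rat _) (pow_mem S_pi _)

lemma S_Bpos (q : ℕ) (hq : 2 ≤ q) : ∑' n : ℕ, (1:ℝ) ^ n / ((n:ℝ) + 1/2) ^ q ∈ Salg := by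
  rw [half_zeta q hq]
  refine mul_mem (sub_mem (S_two_pow _) (one_mem _)) ?_
  rcases Nat.even_or_odd' q with ⟨k, rfl | rfl⟩
  · exact S_zeta_even k (by omega)
  · exact S_zeta k (by omega)

lemma S_B (q : ℕ) (hq : 2 ≤ q) (σ : ℝ) (h : σ = 1 ∨ σ = -1) :
    ∑' n : ℕ, σ ^ n / ((n:ℝ) + 1/2) ^ q ∈ Salg := by
  rcases h with rfl | rfl
  · exact S_Bpos q hq
  · exact S_Bneg q hq

lemma Av_one (q k : ℕ) : Av (q + 1) 1 k = 1 / (k:ℝ) * bv (q + 1) + 1 / (k:ℝ) * Av q 1 k := by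
  rw [Av]
  · rw [Av]; ring

lemma core (σ : ℝ) (h : σ = 1 ∨ σ = -1) (p q : ℕ) (hp : 1 ≤ p) (hq : 2 ≤ q) (hpar : Even (p + q)) :
    TSum p q σ (-σ) ∈ Salg := by
  have hσ : σ * σ = 1 := by rcases h with rfl | rfl <;> norm_num
  have hσ' : |σ| = 1 := by rcases h with rfl | rfl <;> norm_num
  have hτ : -σ = 1 ∨ -σ = -1 := by rcases h with rfl | rfl <;> simp
  have hσS : σ ∈ Salg := by
    rcases h with rfl | rfl
    · exact one_mem _
    · exact neg_mem (one_mem _)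
  have hsgn : (-1:ℝ) ^ p = (-1) ^ q := by
    have : (-1:ℝ) ^ p * (-1) ^ q = 1 := by rw [← pow_add]; exact hpar.neg_one_pow
    have h2 : (-1:ℝ) ^ q * (-1) ^ q = 1 := by rw [← mul_pow]; simp
    linear_combination (-1) ^ q * this - (-1) ^ p * h2
  rcases Nat.lt_or_ge 1 p with hp2 | hp1
  · obtain ⟨C, hC⟩ := bound_const σ hσ' p hp2
    obtain ⟨l, hlS, hl⟩ := Vs_lim (q + p) (by rwa [add_comm]) (fun k => σ ^ k * Av q p k)
      (Vs_sign _ _ σ h _ (Vs_mono _ 2 (min q p) (by omega) (Av_mem q p)))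
    have hL : Tendsto (fun K => oddH K p σ - (fun _ => (0:ℝ)) K) atTop
        (𝓝 (∑' n : ℕ, σ ^ n / ((n:ℝ) + 1/2) ^ p)) := by
      simpa only [oddH, sub_zero] using (summable_half_sign p hp2 σ hσ').hasSum.tendsto_sum_nat
    have rel := main_rel σ hσ hσ' p q 0 hp hq hsgn (fun _ => 0) (by simp) _ hL C
      (by
        intro K n
        simpa using hC K n)
      (by
        intro K n
        have := hC K (-(n:ℤ) - 1)
        push_cast at this
        rw [show -(n:ℝ) - 1 + 1/2 = -((n:ℝ) + 1/2) by ring] at this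
        simpa only [sub_zero, pow_zero, mul_one] using this) l
      (by simpa using hl)
    refine finish σ p q hp hpar l _ hlS ?_ rel
    exact mul_mem (mul_mem (sub_mem hσS (S_sign p)) (S_B p hp2 σ h)) (S_B q hq (-σ) hτ)
  · obtain rfl : p = 1 := by omega
    have hq3 : 1 + 2 ≤ q := by
      by_contra hlt
      obtain rfl : q = 2 := by omega
      exact absurd hpar (by decide)
    obtain ⟨q, rfl⟩ : ∃ q', q = q' + 1 := ⟨q - 1, by omega⟩
    have hV : (fun k : ℕ => 1 / (k:ℝ) * Av q 1 k) ∈ Vs (q + 1 + 1) 2 := by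
      have h1 := Vs_div _ _ _ (Av_mem q 1)
      exact Vs_mono _ 2 (min q 1 + 1) (by omega) h1
    have hev : Even (q + 1 + 1) := by rwa [add_comm] at hpar
    obtain ⟨l, hlS, hl⟩ := Vs_lim _ hev _ (Vs_sign _ _ σ h _ hV)
    rcases h with rfl | rfl
    · obtain ⟨C, hC1, hC2⟩ := bound_lin 1 hσ hσ' (fun K => ∑ k ∈ Finset.range K, 1 / (k:ℝ)) (by simp) _ lim_one
      have rel := main_rel 1 hσ hσ' 1 (q+1) 1 hp hq3 hsgn (fun K => ∑ k ∈ Finset.range K, 1 / (k:ℝ))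
        (by simp) _ lim_one C hC1 hC2 l (by
          refine hl.congr ?_
          intro K
          simp only [one_pow, one_mul, Av_one, Finset.sum_add_distrib, Finset.sum_mul]
          ring)
      refine finish 1 1 (q+1) hp hpar l _ hlS ?_ rel
      refine mul_mem (mul_mem (sub_mem hσS (S_sign 1)) (mul_mem ?_ S_log)) (S_B (q+1) hq (-1) hτ)
      simpa using S_two_pow 1
    · have hL : Tendsto (fun K => oddH K 1 (-1) - (fun _ => (0:ℝ)) K) atTop (𝓝 (Real.pi / 2)) := by
        have := (Real.tendsto_sum_pi_div_four).const_mul 2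
        convert this using 2
        · rw [Finset.mul_sum, sub_zero, oddH]
          refine Finset.sum_congr rfl fun n _ => ?_
          have h := half_pow n 1
          rw [← mul_one_div, h]; simp only [pow_one]; ring
        · ring
      obtain ⟨C, hC1, hC2⟩ := bound_lin (-1) hσ hσ' (fun K => 0) (by simp) _ hL
      have rel := main_rel (-1) hσ hσ' 1 (q+1) 1 hp hq3 hsgn (fun K => 0)
        (by simp) _ hL C hC1 hC2 (-Real.log 2 * bv (q+1) + l) (by
          refine ((lim_alt.mul_const (bv (q+1))).add hl).congr ?_
          intro K
          simp only [Av_one, mul_add, Finset.sum_add_distrib, Finset.sum_mul, zero_mul, sub_zero]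
          congr 1
          refine Finset.sum_congr rfl fun n _ => ?_
          ring)
      refine finish (-1) 1 (q+1) hp hpar _ _ (add_mem (mul_mem (neg_mem S_log) (S_bv _)) hlS) ?_ rel
      simp

lemma q_one (p : ℕ) : TSum p 1 1 (-1) = 0 := by
  unfold TSum
  refine tsum_eq_zero_of_not_summable ?_
  intro hs
  have hs2 := hs.norm
  have h1 : Summable (fun n : ℕ => 1 / ((n:ℝ) + 1)) := by
    rw [← summable_nat_add_iff 1]
    rw [← summable_nat_add_iff 1] at hs2
    refine Summable.of_norm_bounded (hs2.mul_left (1 / 2 ^ p * 2 ^ p * 2 ^ p)) ?_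
    intro n
    have hpos : (0:ℝ) < ((n+1:ℕ):ℝ) + 1/2 := by positivity
    have hh : (2:ℝ) ^ p ≤ oddH (n+1) p 1 := by
      unfold oddH
      rw [Finset.sum_range_succ']
      have : (0:ℝ) ≤ ∑ k ∈ Finset.range n, (1:ℝ) ^ (k+1) / (((k+1:ℕ):ℝ) + 1/2) ^ p :=
        Finset.sum_nonneg fun k _ => by positivity
      have e : (1:ℝ) ^ 0 / (((0:ℕ):ℝ) + 1/2) ^ p = 2 ^ p := by simp
      rw [e]; linarith
    have h2 : (1:ℝ) ≤ 2 ^ p := one_le_pow₀ (by norm_num)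
    have hone : (1:ℝ) ≤ 1 / 2 ^ p * 2 ^ p * 2 ^ p := by
      rw [one_div, inv_mul_cancel₀ (by positivity)]; linarith
    rw [Real.norm_eq_abs, Real.norm_eq_abs, abs_of_nonneg (by positivity), abs_div, abs_mul, abs_pow, abs_neg, abs_one, one_pow, one_mul,
      pow_one, abs_of_pos hpos, abs_of_nonneg (by linarith)]
    calc 1 / (((n+1:ℕ):ℝ) + 1) ≤ 1 / (((n+1:ℕ):ℝ) + 1/2) := by gcongr; norm_num
      _ ≤ oddH (n+1) p 1 / (((n+1:ℕ):ℝ) + 1/2) := by gcongr; linarith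
      _ ≤ _ := le_mul_of_one_le_left (div_nonneg (by linarith) hpos.le) hone
  have := (summable_nat_add_iff (f := fun n : ℕ => 1 / (n:ℝ)) 1).1 (by simpa using h1)
  exact Real.not_summable_one_div_natCast this

theorem stmt3 (p q : ℕ) (hp : 1 ≤ p) (hq : 1 ≤ q) (hpar : Even (p + q)) :
    TSum p q 1 (-1) ∈ Algebra.adjoin ℚ
      ({Real.pi, Real.log 2, betaVal 2}
        ∪ {x : ℝ | ∃ k : ℕ, 1 ≤ k ∧ x = zetaVal (2 * k + 1)}
        ∪ {x : ℝ | ∃ k : ℕ, 2 ≤ k ∧ x = betaVal (2 * k)}) ∧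
    (2 ≤ q →
      TSum p q (-1) 1 ∈ Algebra.adjoin ℚ
        ({Real.pi, Real.log 2, betaVal 2}
          ∪ {x : ℝ | ∃ k : ℕ, 1 ≤ k ∧ x = zetaVal (2 * k + 1)}
          ∪ {x : ℝ | ∃ k : ℕ, 2 ≤ k ∧ x = betaVal (2 * k)})) := by
  refine ⟨?_, ?_⟩
  · rcases Nat.lt_or_ge 1 q with h2 | h1
    · exact core 1 (Or.inl rfl) p q hp h2 hpar
    · obtain rfl : q = 1 := by omega
      rw [q_one]; exact zero_mem _
  · intro h2
    have := core (-1) (Or.inr rfl) p q hp h2 hpar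
    rwa [neg_neg] at this
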